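/- arXiv:2310.13905 — 2 statements merged into one kernel-verified Lean document; each statement's English description precedes it below -/
import Mathlib

section
/- There exists a constant C_n' > 0, depending only on n, such that for every u ∈ l²(ℤⁿ), ‖u‖_{l⁴(ℤⁿ)} ≤ ‖u‖_{l^{2n/(n−1)}(ℤⁿ)} ≤ C_n' · ‖u‖_{D^{1,2}(ℤⁿ)}^{1/2} · ‖u‖_{l²(ℤⁿ)}^{1/2}. -/
open Real

/-- Vertices of the lattice graph `ℤⁿ`. -/
abbrev Zn (n : ℕ) : Type := Fin n → ℤ

/-- The `i`-th standard basis vector. -/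
def ee {n : ℕ} (i : Fin n) : Zn n := fun j => if j = i then 1 else 0

/-- `d(x) = d(x,0) = ∑ |xᵢ|`. -/
def dd {n : ℕ} (x : Zn n) : ℕ := ∑ i, (x i).natAbs

/-- The set of neighbors of `x`, i.e. `{y : d(x,y) = 1}`. -/
def nbrs {n : ℕ} (x : Zn n) : Finset (Zn n) :=
  (Finset.image (fun i : Fin n => x + ee i) Finset.univ) ∪
  (Finset.image (fun i : Fin n => x - ee i) Finset.univ)

/-- The graph Laplacian `Δu(x) = ∑_{y ~ x} (u(y) - u(x))`. -/
def lap {n : ℕ} (u : Zn n → ℝ) (x : Zn n) : ℝ := ∑ y ∈ nbrs x, (u y - u x)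

/-- The vertex boundary `δΩ` of a finite set `Ω ⊂ ℤⁿ`. -/
def bdry {n : ℕ} (Ω : Finset (Zn n)) : Finset (Zn n) := Ω.biUnion nbrs \ Ω

/-- `Ω̄ = Ω ∪ δΩ`. -/
def clos {n : ℕ} (Ω : Finset (Zn n)) : Finset (Zn n) := Ω ∪ bdry Ω

/-- The `l^q` norm `(∑_x |u(x)|^q)^{1/q}`, valued in `ℝ≥0∞`. -/
noncomputable def lqN {n : ℕ} (q : ℝ) (u : Zn n → ℝ) : ENNReal :=
  (∑' x : Zn n, ENNReal.ofReal (|u x| ^ q)) ^ (1 / q)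

/-- The `D^{1,p}` seminorm `(∑_x ∑_{y~x} |u(y)-u(x)|^p)^{1/p}`, valued in `ℝ≥0∞`. -/
noncomputable def d1pN {n : ℕ} (p : ℝ) (u : Zn n → ℝ) : ENNReal :=
  (∑' x : Zn n, ENNReal.ofReal (∑ y ∈ nbrs x, |u y - u x| ^ p)) ^ (1 / p)

open MeasureTheory in
theorem pi_count_eq_count (ι : Type*) [Fintype ι] :
    Measure.pi (fun _ : ι => (Measure.count : Measure ℤ)) = Measure.count := by
  refine Measure.ext_of_singleton fun a => ?_
  rw [Measure.pi_singleton]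
  simp

/-- Loomis–Whitney type inequality for sums over the lattice. -/
theorem tsum_prod_tsum_update_rpow_le {n : ℕ} (hn : 2 ≤ n) (f : Zn n → ENNReal) :
    ∑' x : Zn n, ∏ i, (∑' k : ℤ, f (Function.update x i k)) ^ ((1 : ℝ) / ((n : ℝ) - 1))
      ≤ (∑' x, f x) ^ ((n : ℝ) / ((n : ℝ) - 1)) := by
  have hn' : (2 : ℝ) ≤ n := by exact_mod_cast hn
  have hconj : Real.HolderConjugate (Fintype.card (Fin n) : ℝ) ((n : ℝ) / ((n : ℝ) - 1)) := by
    rw [Fintype.card_fin]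
    exact Real.HolderConjugate.conjExponent (by linarith)
  have h := MeasureTheory.lintegral_prod_lintegral_pow_le
    (fun _ : Fin n => (MeasureTheory.Measure.count : MeasureTheory.Measure ℤ)) hconj
    (f := f) (measurable_of_countable f)
  simpa only [pi_count_eq_count, MeasureTheory.lintegral_count, Fintype.card_fin] using h

theorem enorm_le_tsum_enorm_sub {w : ℤ → ℝ} (hw : Filter.Tendsto w Filter.cofinite (nhds 0))
    (m : ℤ) : ‖w m‖ₑ ≤ ∑' k : ℤ, ‖w (k + 1) - w k‖ₑ := by
  have hstep : ∀ N : ℕ, ‖w m‖ₑ ≤ ‖w (m + N)‖ₑ + ∑ j ∈ Finset.range N,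
      ‖w (m + j + 1) - w (m + j)‖ₑ := by
    intro N
    induction N with
    | zero => simp
    | succ N ih =>
      refine ih.trans ?_
      rw [Finset.sum_range_succ, add_comm (∑ j ∈ _, _), ← add_assoc]
      gcongr
      have h : w (m + N) = w (m + (N + 1 : ℕ)) - (w (m + N + 1) - w (m + N)) := by
        push_cast
        rw [← add_assoc]
        ring
      calc ‖w (m + N)‖ₑ = ‖w (m + (N + 1 : ℕ)) - (w (m + N + 1) - w (m + N))‖ₑ :=
            congrArg _ h
        _ ≤ _ := enorm_sub_le
  have hinj : Function.Injective fun N : ℕ => m + (N : ℤ) := fun a b h => by simpa using h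
  have hbound : ∀ N : ℕ, ‖w m‖ₑ ≤ ‖w (m + N)‖ₑ + ∑' k : ℤ, ‖w (k + 1) - w k‖ₑ := by
    intro N
    refine (hstep N).trans ?_
    gcongr
    refine (ENNReal.sum_le_tsum _).trans ?_
    exact ENNReal.tsum_comp_le_tsum_of_injective hinj fun k : ℤ => ‖w (k + 1) - w k‖ₑ
  have hlim : Filter.Tendsto (fun N : ℕ => w (m + N)) Filter.atTop (nhds 0) := by
    rw [← Nat.cofinite_eq_atTop]
    exact hw.comp hinj.tendsto_cofinite
  have hlim' := (hlim.enorm).add_const (∑' k : ℤ, ‖w (k + 1) - w k‖ₑ)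
  simpa using ge_of_tendsto' hlim' hbound

theorem tsum_rpow_rpow_antitone {α : Type*} (a : α → ENNReal) {p q : ℝ} (hp : 0 < p)
    (hpq : p ≤ q) :
    (∑' x, a x ^ q) ^ (1 / q) ≤ (∑' x, a x ^ p) ^ (1 / p) := by
  have hq : 0 < q := hp.trans_le hpq
  set N := (∑' x, a x ^ p) ^ (1 / p) with hN
  have hNp : ∑' x, a x ^ p = N ^ p := by
    rw [hN, ← ENNReal.rpow_mul, one_div_mul_cancel hp.ne', ENNReal.rpow_one]
  have hle : ∀ x, a x ≤ N := fun x => by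
    rw [← ENNReal.rpow_le_rpow_iff hp, ← hNp]
    exact ENNReal.le_tsum x
  have hsplit : ∀ y : ENNReal, y ^ q = y ^ p * y ^ (q - p) := fun y => by
    rw [← ENNReal.rpow_add_of_nonneg _ _ hp.le (sub_nonneg.2 hpq), add_sub_cancel]
  rw [one_div, ENNReal.rpow_inv_le_iff hq]
  calc ∑' x, a x ^ q ≤ ∑' x, a x ^ p * N ^ (q - p) := by
        refine ENNReal.tsum_le_tsum fun x => ?_
        rw [hsplit]
        have := sub_nonneg.2 hpq
        gcongr
        exact hle x
    _ = N ^ q := by rw [ENNReal.tsum_mul_right, hNp, ← hsplit]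

theorem tsum_mul_le_Lp_mul_Lq {α : Type*} (a b : α → ENNReal) :
    ∑' x, a x * b x
      ≤ (∑' x, a x ^ (2 : ℝ)) ^ ((1 : ℝ) / 2) * (∑' x, b x ^ (2 : ℝ)) ^ ((1 : ℝ) / 2) := by
  let _ : MeasurableSpace α := ⊤
  have h := ENNReal.lintegral_mul_le_Lp_mul_Lq MeasureTheory.Measure.count
    Real.HolderConjugate.two_two (f := a) (g := b) measurable_from_top.aemeasurable
    measurable_from_top.aemeasurable
  simpa only [MeasureTheory.lintegral_count, Pi.mul_apply] using h

theorem update_add_one {n : ℕ} (x : Zn n) (i : Fin n) (k : ℤ) :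
    Function.update x i (k + 1) = Function.update x i k + ee i := by
  ext j
  by_cases h : j = i
  · subst h; simp [ee]
  · simp [ee, h]

theorem lqN_eq {n : ℕ} {q : ℝ} (hq : 0 ≤ q) (u : Zn n → ℝ) :
    lqN q u = (∑' x, ‖u x‖ₑ ^ q) ^ (1 / q) := by
  simp only [lqN, Real.enorm_eq_ofReal_abs, ENNReal.ofReal_rpow_of_nonneg (abs_nonneg _) hq]

theorem tsum_enorm_shift_sub_le_d1pN {n : ℕ} (u : Zn n → ℝ) (i : Fin n) :
    (∑' x, ‖u (x + ee i) - u x‖ₑ ^ (2 : ℝ)) ^ ((1 : ℝ) / 2) ≤ d1pN 2 u := by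
  unfold d1pN
  gcongr with x
  rw [Real.enorm_eq_ofReal_abs, ENNReal.ofReal_rpow_of_nonneg (abs_nonneg _) (by norm_num)]
  refine ENNReal.ofReal_le_ofReal ?_
  refine Finset.single_le_sum (f := fun y => |u y - u x| ^ (2 : ℝ))
    (fun y _ => by positivity) ?_
  simp [nbrs]

theorem tsum_enorm_shift_add_le {n : ℕ} (u : Zn n → ℝ) (i : Fin n) :
    (∑' x, ‖u (x + ee i) + u x‖ₑ ^ (2 : ℝ)) ^ ((1 : ℝ) / 2) ≤ 2 * lqN 2 u := by
  have hshift : ∑' x, ‖u (x + ee i)‖ₑ ^ (2 : ℝ) = ∑' x, ‖u x‖ₑ ^ (2 : ℝ) :=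
    (Equiv.addRight (ee i)).tsum_eq fun x => ‖u x‖ₑ ^ (2 : ℝ)
  have h : ∑' x, ‖u (x + ee i) + u x‖ₑ ^ (2 : ℝ) ≤ 2 ^ (2 : ℝ) * ∑' x, ‖u x‖ₑ ^ (2 : ℝ) := by
    calc ∑' x, ‖u (x + ee i) + u x‖ₑ ^ (2 : ℝ)
        ≤ ∑' x, 2 * (‖u (x + ee i)‖ₑ ^ (2 : ℝ) + ‖u x‖ₑ ^ (2 : ℝ)) := by
          refine ENNReal.tsum_le_tsum fun x => ?_
          refine (ENNReal.rpow_le_rpow (enorm_add_le _ _) (by norm_num)).trans ?_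
          refine (ENNReal.rpow_add_le_mul_rpow_add_rpow _ _ (by norm_num)).trans ?_
          norm_num
      _ = 2 ^ (2 : ℝ) * ∑' x, ‖u x‖ₑ ^ (2 : ℝ) := by
          rw [ENNReal.tsum_mul_left, ENNReal.tsum_add, hshift, ← two_mul, ← mul_assoc]
          norm_num
  rw [lqN_eq (by norm_num)]
  refine (ENNReal.rpow_le_rpow h (by norm_num)).trans ?_
  rw [ENNReal.mul_rpow_of_nonneg _ _ (by norm_num), ← ENNReal.rpow_mul]
  norm_num

theorem tsum_enorm_shift_sq_sub_le {n : ℕ} (u : Zn n → ℝ) (i : Fin n) :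
    ∑' x, ‖u (x + ee i) ^ 2 - u x ^ 2‖ₑ ≤ 2 * (d1pN 2 u * lqN 2 u) := by
  calc ∑' x, ‖u (x + ee i) ^ 2 - u x ^ 2‖ₑ
      = ∑' x, ‖u (x + ee i) - u x‖ₑ * ‖u (x + ee i) + u x‖ₑ := by
        congr 1 with x
        rw [← enorm_mul]
        congr 1
        ring
    _ ≤ d1pN 2 u * (2 * lqN 2 u) := (tsum_mul_le_Lp_mul_Lq _ _).trans
        (mul_le_mul' (tsum_enorm_shift_sub_le_d1pN u i) (tsum_enorm_shift_add_le u i))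
    _ = 2 * (d1pN 2 u * lqN 2 u) := by ring

/-- The `l¹` Gagliardo–Nirenberg–Sobolev inequality on `ℤⁿ`. -/
theorem tsum_enorm_rpow_le {n : ℕ} (hn : 2 ≤ n) {v : Zn n → ℝ}
    (hv : Filter.Tendsto v Filter.cofinite (nhds 0)) :
    ∑' x, ‖v x‖ₑ ^ ((n : ℝ) / ((n : ℝ) - 1))
      ≤ (∑' x, ∑ i, ‖v (x + ee i) - v x‖ₑ) ^ ((n : ℝ) / ((n : ℝ) - 1)) := by
  have hn' : (2 : ℝ) ≤ n := by exact_mod_cast hn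
  have hexp : (0 : ℝ) ≤ 1 / ((n : ℝ) - 1) := one_div_nonneg.2 (by linarith)
  refine le_trans (ENNReal.tsum_le_tsum fun x => ?_) (tsum_prod_tsum_update_rpow_le hn _)
  have hline : ∀ i, ‖v x‖ₑ ≤ ∑' k : ℤ, ∑ j,
      ‖v (Function.update x i k + ee j) - v (Function.update x i k)‖ₑ := by
    intro i
    have h := enorm_le_tsum_enorm_sub
      (hv.comp (Function.update_injective x i).tendsto_cofinite) (x i)
    simp only [Function.comp_apply, Function.update_eq_self, update_add_one] at h
    refine h.trans (ENNReal.tsum_le_tsum fun k => ?_)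
    exact Finset.single_le_sum (f := fun j =>
      ‖v (Function.update x i k + ee j) - v (Function.update x i k)‖ₑ)
      (fun _ _ => zero_le) (Finset.mem_univ i)
  calc ‖v x‖ₑ ^ ((n : ℝ) / ((n : ℝ) - 1))
      = ∏ _i : Fin n, ‖v x‖ₑ ^ ((1 : ℝ) / ((n : ℝ) - 1)) := by
        rw [Finset.prod_const, Finset.card_univ, Fintype.card_fin, ← ENNReal.rpow_natCast,
          ← ENNReal.rpow_mul]
        congr 1
        ring
    _ ≤ _ := Finset.prod_le_prod' fun i _ => ENNReal.rpow_le_rpow (hline i) hexp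

/-- `‖u‖_{l⁴} ≤ ‖u‖_{l^{2n/(n-1)}} ≤ C_n' ‖u‖_{D^{1,2}}^{1/2} ‖u‖_{l²}^{1/2}` on `ℤⁿ`. -/
theorem stmt8 (n : ℕ) (hn : 2 ≤ n) :
    ∃ C : ℝ, 0 < C ∧ ∀ u : Zn n → ℝ, Summable (fun x : Zn n => |u x| ^ (2 : ℝ)) →
      lqN 4 u ≤ lqN (2 * n / ((n : ℝ) - 1)) u ∧
      lqN (2 * n / ((n : ℝ) - 1)) u
        ≤ ENNReal.ofReal C * d1pN 2 u ^ ((1 : ℝ) / 2) * lqN 2 u ^ ((1 : ℝ) / 2) := by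
  have hn' : (2 : ℝ) ≤ n := by exact_mod_cast hn
  have hn1 : (0 : ℝ) < (n : ℝ) - 1 := by linarith
  set p : ℝ := (n : ℝ) / ((n : ℝ) - 1) with hp
  have hp0 : 0 < p := by positivity
  have hq : 2 * n / ((n : ℝ) - 1) = 2 * p := by rw [hp]; ring
  rw [hq]
  refine ⟨(2 * n : ℝ) ^ ((1 : ℝ) / 2), by positivity, fun u hu => ⟨?_, ?_⟩⟩
  · rw [lqN_eq (by norm_num), lqN_eq (by positivity)]
    refine tsum_rpow_rpow_antitone _ (by positivity) ?_
    rw [← hq, div_le_iff₀ hn1]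
    linarith
  · have hv : Filter.Tendsto (fun x => u x ^ 2) Filter.cofinite (nhds 0) := by
      simpa using hu.tendsto_cofinite_zero
    have hgrad : ∑' x, ∑ i, ‖u (x + ee i) ^ 2 - u x ^ 2‖ₑ
        ≤ ENNReal.ofReal (2 * n) * (d1pN 2 u * lqN 2 u) := by
      rw [Summable.tsum_finsetSum fun _ _ => ENNReal.summable]
      refine (Finset.sum_le_sum fun i _ => tsum_enorm_shift_sq_sub_le u i).trans_eq ?_
      rw [Finset.sum_const, Finset.card_univ, Fintype.card_fin, nsmul_eq_mul,
        ENNReal.ofReal_mul (by norm_num), ENNReal.ofReal_natCast, ENNReal.ofReal_ofNat]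
      ring
    have hsq : ∀ x, ‖u x‖ₑ ^ (2 * p) = ‖u x ^ 2‖ₑ ^ p := fun x => by
      rw [ENNReal.rpow_mul, enorm_pow, ENNReal.rpow_ofNat]
    rw [lqN_eq (by positivity), one_div, ENNReal.rpow_inv_le_iff (by positivity)]
    simp only [hsq]
    refine ((tsum_enorm_rpow_le hn hv).trans (ENNReal.rpow_le_rpow hgrad hp0.le)).trans_eq ?_
    rw [← ENNReal.ofReal_rpow_of_nonneg (by positivity) (by norm_num), mul_assoc,
      ← ENNReal.mul_rpow_of_nonneg _ _ (by norm_num),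
      ← ENNReal.mul_rpow_of_nonneg _ _ (by norm_num), ← ENNReal.rpow_mul]
    congr 1
    rw [hp]
    ring
end

section
/- Monotonicity and boundedness of the energy along the iteration: there exists a constant c₀ > 0, depending only on n, λ and ∑_{j=1}^M n_j (in particular independent of Ω), such that c₀ ≥ F(u₁) ≥ F(u₂) ≥ … ≥ F(u_k) ≥ … for the iteration sequence (u_k). -/
open Real

/-- The bilinear form
`D_Ω(f,h) = ½ ∑_{x,y∈Ω, x~y} ∇f∇h + ∑_{x∈Ω, y∈δΩ, x~y} ∇f∇h`. -/
noncomputable def dForm {n : ℕ} (Ω : Finset (Zn n)) (f h : Zn n → ℝ) : ℝ :=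
  (1 / 2) * ∑ x ∈ Ω, ∑ y ∈ nbrs x ∩ Ω, (f y - f x) * (h y - h x)
    + ∑ x ∈ Ω, ∑ y ∈ nbrs x ∩ bdry Ω, (f y - f x) * (h y - h x)

/-- The outward normal derivative `∂f/∂n⃗(x) = ∑_{y ∈ Ω, y ~ x} (f(x) - f(y))` at `x ∈ δΩ`. -/
noncomputable def nder {n : ℕ} (Ω : Finset (Zn n)) (f : Zn n → ℝ) (x : Zn n) : ℝ :=
  ∑ y ∈ nbrs x ∩ Ω, (f x - f y)

/-- `Ω` is connected in the graph sense. -/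
def connFinset {n : ℕ} (Ω : Finset (Zn n)) : Prop :=
  ∀ x ∈ Ω, ∀ y ∈ Ω, ∃ (m : ℕ) (c : ℕ → Zn n),
    c 0 = x ∧ c m = y ∧ (∀ i ≤ m, c i ∈ Ω) ∧ ∀ i < m, c (i + 1) ∈ nbrs (c i)

/-- The energy functional `F(v) = ½ D_Ω(v) + ∑_{x∈Ω} [ (λ/2)(e^{v(x)}-1)² + g(x)v(x) ]`. -/
noncomputable def engF {n : ℕ} (Ω : Finset (Zn n)) (lam : ℝ) (g : Zn n → ℝ)
    (v : Zn n → ℝ) : ℝ :=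
  (1 / 2) * dForm Ω v v
    + ∑ x ∈ Ω, ((lam / 2) * (Real.exp (v x) - 1) ^ 2 + g x * v x)

lemma mem_nbrs {n : ℕ} {x y : Zn n} :
    y ∈ nbrs x ↔ (∃ i, x + ee i = y) ∨ ∃ i, x - ee i = y := by
  simp [nbrs]

lemma mem_nbrs_comm {n : ℕ} {x y : Zn n} : y ∈ nbrs x ↔ x ∈ nbrs y := by
  have key : ∀ x y : Zn n, y ∈ nbrs x → x ∈ nbrs y := by
    intro x y h
    rw [mem_nbrs] at h ⊢
    rcases h with ⟨i, rfl⟩ | ⟨i, rfl⟩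
    · exact Or.inr ⟨i, by simp⟩
    · exact Or.inl ⟨i, by simp⟩
  exact ⟨key x y, key y x⟩

lemma mem_or_mem_bdry_of_mem_nbrs {n : ℕ} {Ω : Finset (Zn n)} {x y : Zn n} (hx : x ∈ Ω)
    (hy : y ∈ nbrs x) : y ∈ Ω ∨ y ∈ bdry Ω := by
  by_cases h : y ∈ Ω
  · exact Or.inl h
  · exact Or.inr (Finset.mem_sdiff.2 ⟨Finset.mem_biUnion.2 ⟨x, hx, hy⟩, h⟩)

/-- A sum over the neighbors of a point of `Ω` splits into its parts in `Ω` and in `δΩ`. -/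
lemma sum_nbrs_eq {n : ℕ} {Ω : Finset (Zn n)} {x : Zn n} (hx : x ∈ Ω) (a : Zn n → ℝ) :
    ∑ y ∈ nbrs x, a y = ∑ y ∈ nbrs x ∩ Ω, a y + ∑ y ∈ nbrs x ∩ bdry Ω, a y := by
  rw [← Finset.sum_union]
  · congr 1
    rw [← Finset.inter_union_distrib_left, eq_comm, Finset.inter_eq_left]
    intro y hy
    exact Finset.mem_union.2 (mem_or_mem_bdry_of_mem_nbrs hx hy)
  · rw [Finset.disjoint_left]
    intro y hy hy'
    exact (Finset.mem_sdiff.1 (Finset.mem_inter.1 hy').2).2 (Finset.mem_inter.1 hy).2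

lemma sum_sum_nbrs_inter_comm {n : ℕ} (Ω : Finset (Zn n)) (a : Zn n → Zn n → ℝ) :
    ∑ x ∈ Ω, ∑ y ∈ nbrs x ∩ Ω, a x y = ∑ x ∈ Ω, ∑ y ∈ nbrs x ∩ Ω, a y x := by
  refine Finset.sum_comm' fun x y => ?_
  simp only [Finset.mem_inter]
  rw [mem_nbrs_comm]
  tauto

/-- Green's formula for test functions vanishing on the boundary. -/
lemma sum_lap_mul {n : ℕ} {Ω : Finset (Zn n)} (v φ : Zn n → ℝ) (hφ : ∀ x ∈ bdry Ω, φ x = 0) :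
    ∑ x ∈ Ω, lap v x * φ x = -dForm Ω v φ := by
  have h1 : ∑ x ∈ Ω, lap v x * φ x
      = ∑ x ∈ Ω, ∑ y ∈ nbrs x ∩ Ω, (v y - v x) * φ x
        + ∑ x ∈ Ω, ∑ y ∈ nbrs x ∩ bdry Ω, (v y - v x) * φ x := by
    rw [← Finset.sum_add_distrib]
    refine Finset.sum_congr rfl fun x hx => ?_
    rw [lap, Finset.sum_mul, sum_nbrs_eq hx]
  have h2 : ∑ x ∈ Ω, ∑ y ∈ nbrs x ∩ bdry Ω, (v y - v x) * φ x
      = -∑ x ∈ Ω, ∑ y ∈ nbrs x ∩ bdry Ω, (v y - v x) * (φ y - φ x) := by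
    rw [← Finset.sum_neg_distrib]
    refine Finset.sum_congr rfl fun x _ => ?_
    rw [← Finset.sum_neg_distrib]
    refine Finset.sum_congr rfl fun y hy => ?_
    rw [hφ y (Finset.mem_inter.1 hy).2]
    ring
  have h3 := sum_sum_nbrs_inter_comm Ω fun x y => (v y - v x) * φ x
  have h4 : ∑ x ∈ Ω, ∑ y ∈ nbrs x ∩ Ω, (v y - v x) * (φ y - φ x)
      = -∑ x ∈ Ω, ∑ y ∈ nbrs x ∩ Ω, (v x - v y) * φ y
        - ∑ x ∈ Ω, ∑ y ∈ nbrs x ∩ Ω, (v y - v x) * φ x := by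
    simp only [← Finset.sum_neg_distrib, ← Finset.sum_sub_distrib]
    exact Finset.sum_congr rfl fun x _ => Finset.sum_congr rfl fun y _ => by ring
  rw [h1, h2, dForm, h4, ← h3]
  ring

lemma dForm_self_nonneg {n : ℕ} (Ω : Finset (Zn n)) (f : Zn n → ℝ) : 0 ≤ dForm Ω f f := by
  have h (s : Zn n → Finset (Zn n)) :
      0 ≤ ∑ x ∈ Ω, ∑ y ∈ s x, (f y - f x) * (f y - f x) :=
    Finset.sum_nonneg fun _ _ => Finset.sum_nonneg fun _ _ => mul_self_nonneg _
  have h1 := h fun x => nbrs x ∩ Ω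
  have h2 := h fun x => nbrs x ∩ bdry Ω
  rw [dForm]
  linarith

lemma dForm_self_sub_dForm_self {n : ℕ} (Ω : Finset (Zn n)) (u v : Zn n → ℝ) :
    dForm Ω v v - dForm Ω u u
      = 2 * dForm Ω v (fun x => v x - u x)
        - dForm Ω (fun x => v x - u x) (fun x => v x - u x) := by
  have h (s : Zn n → Finset (Zn n)) :
      ∑ x ∈ Ω, ∑ y ∈ s x, (v y - v x) * (v y - v x)
        - ∑ x ∈ Ω, ∑ y ∈ s x, (u y - u x) * (u y - u x)
      = 2 * ∑ x ∈ Ω, ∑ y ∈ s x, (v y - v x) * (v y - u y - (v x - u x))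
        - ∑ x ∈ Ω, ∑ y ∈ s x,
            (v y - u y - (v x - u x)) * (v y - u y - (v x - u x)) := by
    simp only [Finset.mul_sum, ← Finset.sum_sub_distrib]
    exact Finset.sum_congr rfl fun x _ => Finset.sum_congr rfl fun y _ => by ring
  have h1 := h fun x => nbrs x ∩ Ω
  have h2 := h fun x => nbrs x ∩ bdry Ω
  simp only [dForm]
  linarith

/-- The maximum principle for `Δ - K` with `K > 0`. -/
lemma nonpos_of_lap_sub_nonneg {n : ℕ} {Ω : Finset (Zn n)} {K : ℝ} (hK : 0 < K) {v : Zn n → ℝ}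
    (hv : ∀ x ∈ Ω, 0 ≤ lap v x - K * v x) (hb : ∀ x ∈ bdry Ω, v x = 0) :
    ∀ x ∈ Ω, v x ≤ 0 := by
  intro x₀ hx₀
  obtain ⟨x, hx, hmax⟩ := Ω.exists_max_image v ⟨x₀, hx₀⟩
  refine (hmax x₀ hx₀).trans ?_
  by_contra! hpos
  have hlap : lap v x ≤ 0 := by
    refine Finset.sum_nonpos fun y hy => sub_nonpos.2 ?_
    rcases mem_or_mem_bdry_of_mem_nbrs hx hy with h | h
    · exact hmax y h
    · exact (hb y h).trans_le hpos.le
  have := hv x hx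
  have := mul_pos hK hpos
  linarith

lemma exp_mul_exp_sub_one_nonneg {lam K t : ℝ} (hlam : 0 < lam) (hK : lam ≤ K) (ht : t ≤ 0) :
    0 ≤ lam * (exp t * (exp t - 1)) - K * t := by
  have h1 := add_one_le_exp t
  have h2 := exp_pos t
  have h3 : exp t ≤ 1 := exp_le_one_iff.2 ht
  have h4 : t ≤ exp t * (exp t - 1) := by nlinarith
  nlinarith

lemma sq_exp_sub_exp_le {u v : ℝ} (hu : u ≤ 0) (hv : v ≤ 0) :
    (exp v - exp u) ^ 2 ≤ (v - u) ^ 2 := by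
  have key : ∀ s t : ℝ, s ≤ t → t ≤ 0 → (exp t - exp s) ^ 2 ≤ (t - s) ^ 2 := by
    intro s t hst ht
    have h1 : exp s ≤ exp t := exp_le_exp.2 hst
    have h2 : exp t ≤ 1 := exp_le_one_iff.2 ht
    have h3 : exp s = exp t * exp (s - t) := by rw [← exp_add]; ring_nf
    have h4 := add_one_le_exp (s - t)
    have h5 := exp_pos t
    have h6 : exp t - exp s ≤ t - s := by rw [h3]; nlinarith
    exact pow_le_pow_left₀ (by linarith) h6 2
  rcases le_total u v with h | h
  · exact key u v h hv
  · have := key v u h hu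
    nlinarith

/-- A second-order Taylor bound for `t ↦ (e^t - 1)² / 2` on the nonpositive reals. -/
lemma half_sq_exp_sub_one_sub_le {u v : ℝ} (hu : u ≤ 0) (hv : v ≤ 0) :
    (exp v - 1) ^ 2 / 2 - (exp u - 1) ^ 2 / 2
      ≤ exp u * (exp u - 1) * (v - u) + (v - u) ^ 2 / 2 := by
  have h1 := sq_exp_sub_exp_le hu hv
  have h2 : exp u ≤ 1 := exp_le_one_iff.2 hu
  have h3 : exp v = exp u * exp (v - u) := by rw [← exp_add]; ring_nf
  have h4 : exp u * (v - u + 1) ≤ exp v := by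
    rw [h3]
    exact mul_le_mul_of_nonneg_left (add_one_le_exp _) (exp_pos u).le
  nlinarith [mul_nonneg (sub_nonneg.2 h2) (sub_nonneg.2 h4)]

/-- One step of the iteration between nonpositive functions does not increase the energy. -/
lemma engF_le_of_step {n : ℕ} {Ω : Finset (Zn n)} {lam K : ℝ} (hlam : 0 < lam) (hK : lam ≤ K)
    {g u v : Zn n → ℝ} (hu : ∀ x ∈ Ω, u x ≤ 0) (hv : ∀ x ∈ Ω, v x ≤ 0)
    (hub : ∀ x ∈ bdry Ω, u x = 0) (hvb : ∀ x ∈ bdry Ω, v x = 0)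
    (hstep : ∀ x ∈ Ω, lap v x - K * v x
      = lam * (exp (u x) * (exp (u x) - 1)) + g x - K * u x) :
    engF Ω lam g v ≤ engF Ω lam g u := by
  have hgreen := sum_lap_mul (Ω := Ω) v (fun x => v x - u x)
    fun x hx => by simp [hub x hx, hvb x hx]
  have hD := dForm_self_sub_dForm_self Ω u v
  have hpos := dForm_self_nonneg Ω fun x => v x - u x
  have hsum : ∑ x ∈ Ω, ((lam / 2) * (exp (v x) - 1) ^ 2 + g x * v x)
      ≤ ∑ x ∈ Ω, ((lam / 2) * (exp (u x) - 1) ^ 2 + g x * u x)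
        + ∑ x ∈ Ω, lap v x * (v x - u x) := by
    rw [← Finset.sum_add_distrib]
    refine Finset.sum_le_sum fun x hx => ?_
    have h1 := mul_le_mul_of_nonneg_left
      (half_sq_exp_sub_one_sub_le (hu x hx) (hv x hx)) hlam.le
    have h2 : lap v x
        = lam * (exp (u x) * (exp (u x) - 1)) + g x + K * (v x - u x) := by
      linarith [hstep x hx]
    rw [h2]
    have h3 := mul_le_mul_of_nonneg_right hK (sq_nonneg (v x - u x))
    have h4 := mul_nonneg hlam.le (sq_nonneg (v x - u x))
    linarith
  simp only [engF]
  linarith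

lemma engF_eq_zero {n : ℕ} {Ω : Finset (Zn n)} {lam : ℝ} {g v : Zn n → ℝ}
    (hv : ∀ x ∈ clos Ω, v x = 0) : engF Ω lam g v = 0 := by
  have hΩ : ∀ x ∈ Ω, v x = 0 := fun x hx => hv x (Finset.mem_union_left _ hx)
  have hb : ∀ x ∈ bdry Ω, v x = 0 := fun x hx => hv x (Finset.mem_union_right _ hx)
  have h1 : ∑ x ∈ Ω, lap v x * v x = 0 :=
    Finset.sum_eq_zero fun x hx => by simp [hΩ x hx]
  have h2 : ∑ x ∈ Ω, ((lam / 2) * (exp (v x) - 1) ^ 2 + g x * v x) = 0 :=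
    Finset.sum_eq_zero fun x hx => by simp [hΩ x hx]
  have h3 := sum_lap_mul v v hb
  rw [engF, h2]
  linarith

/-- Monotonicity and boundedness of the energy along the iteration: the bound `c₀`
depends only on `n`, `λ` and `S = ∑ⱼ nⱼ`, in particular it is independent of `Ω`. -/
theorem stmt15 (n : ℕ) (hn : 2 ≤ n) (lam : ℝ) (hlam : 0 < lam) (S : ℕ) :
    ∃ c₀ : ℝ, 0 < c₀ ∧
      ∀ (M : ℕ), 1 ≤ M → ∀ nn : Fin M → ℕ, (∀ j, 0 < nn j) → (∑ j, nn j) = S →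
      ∀ p : Fin M → Zn n, Function.Injective p →
      ∀ g : Zn n → ℝ,
        (∀ x, g x = ∑ j, if x = p j then 4 * Real.pi * (nn j : ℝ) else 0) →
      ∀ K : ℝ, 2 * lam < K →
      ∀ Ω : Finset (Zn n), (∀ j, p j ∈ Ω) → connFinset Ω →
      ∀ U : ℕ → Zn n → ℝ,
        (∀ x ∈ clos Ω, U 0 x = 0) →
        (∀ k : ℕ, ∀ x ∈ Ω,
          lap (U (k + 1)) x - K * U (k + 1) x
            = lam * (Real.exp (U k x) * (Real.exp (U k x) - 1)) + g x - K * U k x) →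
        (∀ k : ℕ, ∀ x ∈ bdry Ω, U (k + 1) x = 0) →
        engF Ω lam g (U 1) ≤ c₀ ∧
        ∀ k : ℕ, 1 ≤ k → engF Ω lam g (U (k + 1)) ≤ engF Ω lam g (U k) := by
  refine ⟨1, one_pos, ?_⟩
  intro M _ nn _ _ p _ g hg K hK Ω _ _ U hU0 hU hUb
  have hg0 : ∀ x, 0 ≤ g x := by
    intro x
    rw [hg]
    refine Finset.sum_nonneg fun j _ => ?_
    split_ifs <;> positivity
  have hb : ∀ k, ∀ x ∈ bdry Ω, U k x = 0 := by
    rintro (_ | k) x hx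
    · exact hU0 x (Finset.mem_union_right _ hx)
    · exact hUb k x hx
  have hle : ∀ k, ∀ x ∈ Ω, U k x ≤ 0 := by
    intro k
    induction k with
    | zero => exact fun x hx => (hU0 x (Finset.mem_union_left _ hx)).le
    | succ k ih =>
      refine nonpos_of_lap_sub_nonneg (by linarith) (fun x hx => ?_) (hb (k + 1))
      have := exp_mul_exp_sub_one_nonneg (K := K) hlam (by linarith) (ih x hx)
      rw [hU k x hx]
      linarith [hg0 x]
  have hmono : ∀ k, engF Ω lam g (U (k + 1)) ≤ engF Ω lam g (U k) := fun k =>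
    engF_le_of_step hlam (by linarith) (hle k) (hle (k + 1)) (hb k) (hb (k + 1)) (hU k)
  refine ⟨?_, fun k _ => hmono k⟩
  have h0 := hmono 0
  rw [engF_eq_zero hU0] at h0
  exact h0.trans zero_le_one
end
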